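/- Let C be an entry-faithful (X,2)-neighbour transitive code in H(m,q) with |C| ≥ 2 and minimum distance δ ≥ 5. Then X acts 2-transitively on the set of entries M (the action via μ being faithful and 2-transitive). -/

import Mathlib

open Equiv

namespace NT

/-- Vertices of the Hamming graph `H(m,q)`. -/
abbrev V (m q : ℕ) := Fin m → Fin q

/-- The automorphism of `H(m,q)` determined by alphabet permutations `g` and
an entry permutation `σ`:  `α ↦ (i ↦ gᵢ (α (σ⁻¹ i)))`. -/
def hAut (m q : ℕ) (g : Fin m → Perm (Fin q)) (σ : Perm (Fin m)) :
    Perm (V m q) where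
  toFun α := fun i => g i (α (σ⁻¹ i))
  invFun α := fun i => (g (σ i))⁻¹ (α (σ i))
  left_inv α := by funext i; simp
  right_inv α := by funext i; simp

/-- The automorphism group of the Hamming graph, as a subgroup of the group of
all permutations of the vertex set:  `S_q^m ⋊ S_m`. -/
def HammingAut (m q : ℕ) : Subgroup (Perm (V m q)) where
  carrier := {x | ∃ g σ, x = hAut m q g σ}
  one_mem' := ⟨fun _ => 1, 1, by ext α i; simp [hAut]⟩
  mul_mem' := by
    rintro x y ⟨g, σ, rfl⟩ ⟨h, τ, rfl⟩
    exact ⟨fun i => g i * h (σ⁻¹ i), σ * τ, by ext α i; simp [hAut, Perm.mul_apply]⟩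
  inv_mem' := by
    rintro x ⟨g, σ, rfl⟩
    refine ⟨fun i => (g (σ i))⁻¹, σ⁻¹, ?_⟩
    ext α i
    simp [hAut, Perm.inv_def]

/-- The minimum distance of a code `C ⊆ H(m,q)`. -/
noncomputable def minDist (m q : ℕ) (C : Set (V m q)) : ℕ :=
  sInf {d | ∃ α ∈ C, ∃ β ∈ C, α ≠ β ∧ hammingDist α β = d}

/-- The distance `d(α, C)` from a vertex to a code. -/
noncomputable def distTo (m q : ℕ) (C : Set (V m q)) (α : V m q) : ℕ :=
  sInf {d | ∃ β ∈ C, hammingDist α β = d}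

/-- `C_r`, the set of vertices at distance exactly `r` from the code `C`. -/
def cell (m q : ℕ) (C : Set (V m q)) (r : ℕ) : Set (V m q) :=
  {α | distTo m q C α = r}

/-- The covering radius of a code. -/
noncomputable def covRad (m q : ℕ) (C : Set (V m q)) : ℕ :=
  sSup (Set.range (distTo m q C))

/-- `S` is an orbit of the subgroup `X ≤ Sym(V)`. -/
def IsOrbit (m q : ℕ) (X : Subgroup (Perm (V m q))) (S : Set (V m q)) : Prop :=
  S.Nonempty ∧ (∀ x ∈ X, ∀ ν ∈ S, x ν ∈ S) ∧
    ∀ ν ∈ S, ∀ μ ∈ S, ∃ x ∈ X, x ν = μ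

/-- `C` is `(X,s)`-neighbour transitive:  `X` is a group of automorphisms of the
Hamming graph and each of `C, C_1, …, C_s` is an `X`-orbit. -/
def IsNT (m q : ℕ) (X : Subgroup (Perm (V m q))) (C : Set (V m q)) (s : ℕ) : Prop :=
  X ≤ HammingAut m q ∧ IsOrbit m q X C ∧
    ∀ i, 1 ≤ i → i ≤ s → IsOrbit m q X (cell m q C i)

/-- `X` acts faithfully on the set of entries, i.e. `X ∩ S_q^m = 1`. -/
def EntryFaithful (m q : ℕ) (X : Subgroup (Perm (V m q))) : Prop :=
  ∀ x ∈ X, (∃ g, x = hAut m q g 1) → x = 1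

/-- The image of `X` in `S_m` under the entry action `μ`. -/
def entryImage (m q : ℕ) (X : Subgroup (Perm (V m q))) : Set (Perm (Fin m)) :=
  {σ | ∃ x ∈ X, ∃ g, x = hAut m q g σ}

/-- Two codes are equivalent if one is the image of the other under an
automorphism of the Hamming graph. -/
def CodeEquiv (m q : ℕ) (C C' : Set (V m q)) : Prop :=
  ∃ x ∈ HammingAut m q, x '' C = C'

/-- The repetition code: all constant tuples. -/
def RepCode (m q : ℕ) : Set (V m q) := {α | ∃ a, α = fun _ => a}

/-- The zero vertex. -/
def zeroV (m q : ℕ) [NeZero q] : V m q := fun _ => 0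

/-- The weight of a vertex: the number of nonzero entries. -/
noncomputable def wt (m q : ℕ) [NeZero q] (α : V m q) : ℕ :=
  hammingNorm α

/-- `α` covers `ν` if `α` agrees with `ν` on every nonzero entry of `ν`. -/
def Covers (m q : ℕ) [NeZero q] (α ν : V m q) : Prop :=
  ∀ i, ν i ≠ 0 → ν i = α i

/-- A `q`-ary `s-(m,k,λ)` design: a set of weight-`k` vertices such that every
weight-`s` vertex is covered by exactly `λ` of them. -/
noncomputable def IsDesign (m q : ℕ) [NeZero q] (s k lam : ℕ) (D : Set (V m q)) : Prop :=
  (∀ α ∈ D, wt m q α = k) ∧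
    ∀ ν : V m q, wt m q ν = s → {α ∈ D | Covers m q α ν}.ncard = lam

/-- `C` is `s`-regular: for each `i ≤ s` and `k ≤ m`, the number
`|Γ_k(ν) ∩ C|` is the same for all `ν ∈ C_i`. -/
def SRegular (m q : ℕ) (C : Set (V m q)) (s : ℕ) : Prop :=
  ∀ i ≤ s, ∀ k ≤ m, ∀ ν ∈ cell m q C i, ∀ μ ∈ cell m q C i,
    {β ∈ C | hammingDist ν β = k}.ncard = {β ∈ C | hammingDist μ β = k}.ncard

/-- The automorphism group of a code: the setwise stabiliser of `C` in the
automorphism group of the Hamming graph. -/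
def AutCode (m q : ℕ) (C : Set (V m q)) : Subgroup (Perm (V m q)) where
  carrier := {x | x ∈ HammingAut m q ∧ x '' C = C}
  one_mem' := ⟨(HammingAut m q).one_mem, by simp⟩
  mul_mem' := by
    rintro x y ⟨hx, hx'⟩ ⟨hy, hy'⟩
    exact ⟨mul_mem hx hy, by rw [Perm.coe_mul, Set.image_comp, hy', hx']⟩
  inv_mem' := by
    rintro x ⟨hx, hx'⟩
    refine ⟨inv_mem hx, ?_⟩
    conv_lhs => rw [← hx']
    rw [← Set.image_comp]
    simp [Perm.inv_def]

/-- `N` is a minimal normal subgroup of the (sub)group `H`. -/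
def IsMinNormalIn {G : Type*} [Group G] (H N : Subgroup G) : Prop :=
  N ≤ H ∧ N ≠ ⊥ ∧ (∀ h ∈ H, ∀ n ∈ N, h * n * h⁻¹ ∈ N) ∧
    ∀ K : Subgroup G, K ≤ H → K ≠ ⊥ →
      (∀ h ∈ H, ∀ k ∈ K, h * k * h⁻¹ ∈ K) → K ≤ N → K = N

/-- The socle of a subgroup `H`: the subgroup generated by all minimal
normal subgroups of `H`. -/
def socleIn {G : Type*} [Group G] (H : Subgroup G) : Subgroup G :=
  ⨆ N ∈ {N : Subgroup G | IsMinNormalIn H N}, N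

/-- A row of the punctured Hadamard 12 code: the binary vector whose entry at
`a ∈ F₁₁` is `1` exactly when `a - b` is a square in `F₁₁` (including `0`),
corresponding to the translate by `b` of the first row of the normalised Paley
Hadamard matrix of order 12 (with the `*` coordinate deleted, and with the
Hadamard entry `-1` encoded as `1`, `1` as `0`). -/
def hadRow (b : ZMod 11) : V 11 2 :=
  fun i => if ∃ c : ZMod 11, c ^ 2 = ((i : ℕ) : ZMod 11) - b then 1 else 0

/-- The punctured Hadamard code of length 12 in `H(11,2)`: the zero vector and
all-ones vector (from the all-`(-1)` row of `-H₁₂` and of `H₁₂`), the eleven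
weight-6 rows `hadRow b`, and their complements (the rows of `-H₁₂`). -/
def PHad : Set (V 11 2) :=
  {(fun _ => 0), (fun _ => 1)} ∪ Set.range hadRow ∪
    Set.range (fun b => (fun i => 1 - hadRow b i : V 11 2))

/-- The even weight subcode of the punctured Hadamard code of length 12: the
zero vector together with the eleven weight-6 codewords. -/
def ESub : Set (V 11 2) :=
  insert (fun _ => 0) (Set.range hadRow)

end NT

namespace NT

variable {m q : ℕ}

theorem hAut_apply_apply (g : Fin m → Perm (Fin q)) (σ : Perm (Fin m)) (v : V m q)
    (i : Fin m) : hAut m q g σ v (σ i) = g (σ i) (v i) := by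
  simp [hAut]

theorem hAut_mul (g h : Fin m → Perm (Fin q)) (σ τ : Perm (Fin m)) :
    hAut m q g σ * hAut m q h τ = hAut m q (fun i => g i * h (σ⁻¹ i)) (σ * τ) := by
  ext α i
  simp [hAut, Perm.mul_apply]

theorem hAut_apply_eq_iff (g : Fin m → Perm (Fin q)) (σ : Perm (Fin m)) (v w : V m q)
    (i : Fin m) : hAut m q g σ v (σ i) = hAut m q g σ w (σ i) ↔ v i = w i := by
  simp [hAut_apply_apply]

theorem hammingDist_hAut (g : Fin m → Perm (Fin q)) (σ : Perm (Fin m)) (v w : V m q) :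
    hammingDist (hAut m q g σ v) (hAut m q g σ w) = hammingDist v w := by
  unfold hammingDist
  symm
  refine Finset.card_bij (fun i _ => σ i) ?_ (fun i _ j _ h => σ.injective h) ?_
  · intro i hi
    simpa [hAut_apply_eq_iff] using hi
  · intro j hj
    obtain ⟨i, rfl⟩ := σ.surjective j
    exact ⟨i, by simpa [hAut_apply_eq_iff] using hj, rfl⟩

theorem exists_ne_symbol (hq : 2 ≤ q) (a : Fin q) : ∃ b, b ≠ a := by
  have : Nontrivial (Fin q) := Fin.nontrivial_iff_two_le.mpr hq
  exact exists_ne a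

/-- An automorphism that is trivial on vertices is trivial on entries. -/
theorem eq_one_of_hAut_eq_one (hq : 2 ≤ q) {g : Fin m → Perm (Fin q)} {σ : Perm (Fin m)}
    (h : hAut m q g σ = 1) : σ = 1 := by
  ext1 i
  by_contra hi
  let v : V m q := fun _ => ⟨0, by omega⟩
  obtain ⟨b, hb⟩ := exists_ne_symbol hq (v i)
  have key := hAut_apply_eq_iff g σ (Function.update v i b) v i
  rw [h] at key
  have hi' : σ i ≠ i := hi
  simp only [Perm.one_apply, Function.update_self, Function.update_of_ne hi', true_iff] at key
  exact hb key

/-- If an automorphism fixes `α` and maps `ν` to `μ`, its entry permutation matches up the entries in which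
`ν` and `μ` differ from `α`. -/
theorem apply_ne_iff_of_fixes {g : Fin m → Perm (Fin q)} {σ : Perm (Fin m)} {α ν μ : V m q}
    (hα : hAut m q g σ α = α) (hν : hAut m q g σ ν = μ) (i : Fin m) :
    μ (σ i) ≠ α (σ i) ↔ ν i ≠ α i := by
  have := hAut_apply_eq_iff g σ ν α i
  rw [hα, hν] at this
  exact not_congr this

theorem minDist_le {C : Set (V m q)} {α β : V m q} (hα : α ∈ C) (hβ : β ∈ C) (h : α ≠ β) :
    minDist m q C ≤ hammingDist α β :=
  Nat.sInf_le ⟨α, hα, β, hβ, h, rfl⟩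

theorem mem_cell_of_hammingDist_eq {C : Set (V m q)} {r : ℕ} (hr : 2 * r ≤ minDist m q C)
    {α ν : V m q} (hα : α ∈ C) (hν : hammingDist ν α = r) : ν ∈ cell m q C r := by
  refine le_antisymm (Nat.sInf_le ⟨α, hα, hν⟩) (le_csInf ⟨r, α, hα, hν⟩ ?_)
  rintro d ⟨β, hβ, rfl⟩
  by_cases h : α = β
  · rw [← h, hν]
  · have h1 := minDist_le hα hβ h
    have h2 := hammingDist_triangle α ν β
    rw [hammingDist_comm α ν] at h2
    omega

/-- The stabiliser of a codeword is transitive on the vertices at distance `r` from it,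
when `r` is below half the minimum distance. -/
theorem IsNT.exists_fixing {X : Subgroup (Perm (V m q))} {C : Set (V m q)} {s r : ℕ}
    (hNT : IsNT m q X C s) (hr : 1 ≤ r) (hrs : r ≤ s) (hδ : 2 * r < minDist m q C)
    {α ν μ : V m q} (hα : α ∈ C) (hν : hammingDist ν α = r) (hμ : hammingDist μ α = r) :
    ∃ g σ, hAut m q g σ ∈ X ∧ hAut m q g σ α = α ∧ hAut m q g σ ν = μ := by
  obtain ⟨x, hx, hxν⟩ := (hNT.2.2 r hr hrs).2.2 ν (mem_cell_of_hammingDist_eq hδ.le hα hν)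
    μ (mem_cell_of_hammingDist_eq hδ.le hα hμ)
  obtain ⟨g, σ, rfl⟩ := hNT.1 hx
  refine ⟨g, σ, hx, ?_, hxν⟩
  by_contra h
  have h1 := minDist_le (hNT.2.1.2.1 _ hx α hα) hα h
  have h2 := hammingDist_triangle (hAut m q g σ α) μ α
  have h3 := hammingDist_hAut g σ α ν
  rw [hxν, hammingDist_comm α ν] at h3
  omega

theorem hammingDist_update {α : V m q} {i : Fin m} {a : Fin q} (ha : a ≠ α i) :
    hammingDist (Function.update α i a) α = 1 := by
  have : Finset.univ.filter (fun k => Function.update α i a k ≠ α k) = {i} := by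
    ext k
    by_cases hk : k = i
    · subst hk; simpa using ha
    · simp [hk]
  simp only [hammingDist, this, Finset.card_singleton]

theorem hammingDist_update_update {α : V m q} {i j : Fin m} (hij : i ≠ j) {a b : Fin q}
    (ha : a ≠ α i) (hb : b ≠ α j) :
    hammingDist (Function.update (Function.update α i a) j b) α = 2 := by
  have : Finset.univ.filter
      (fun k => Function.update (Function.update α i a) j b k ≠ α k) = {i, j} := by
    ext k
    by_cases hk : k = j
    · subst hk; simpa using hb
    · by_cases hk' : k = i
      · subst hk'; simpa [hk] using ha
      · simp [hk, hk']
  simp only [hammingDist, this, Finset.card_pair hij]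

variable {X : Subgroup (Perm (V m q))} {C : Set (V m q)}

/-- The stabiliser of a codeword and an entry is transitive on the symbols in that entry
other than the one of the codeword. -/
theorem IsNT.exists_fixing_symbol (hNT : IsNT m q X C 2) (hδ : 5 ≤ minDist m q C)
    {α : V m q} (hα : α ∈ C) {i j : Fin m} {a b : Fin q} (ha : a ≠ α i) (hb : b ≠ α j) :
    ∃ g σ, hAut m q g σ ∈ X ∧ hAut m q g σ α = α ∧ σ i = j ∧ g j a = b := by
  obtain ⟨g, σ, hX, hfix, hmap⟩ := hNT.exists_fixing (r := 1) le_rfl (by norm_num) (by omega) hα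
    (hammingDist_update ha) (hammingDist_update hb)
  have hσ : σ i = j := by
    by_contra h
    have := (apply_ne_iff_of_fixes hfix hmap i).2 (by simpa using ha)
    simp [Function.update_of_ne h] at this
  refine ⟨g, σ, hX, hfix, hσ, ?_⟩
  have := hAut_apply_apply g σ (Function.update α i a) i
  rw [hmap, hσ] at this
  simpa using this.symm

/-- The stabiliser of a codeword is `2`-homogeneous on entries. -/
theorem IsNT.exists_entry_pair (hNT : IsNT m q X C 2) (hq : 2 ≤ q) (hδ : 5 ≤ minDist m q C)
    {α : V m q} (hα : α ∈ C) {i j k l : Fin m} (hij : i ≠ j) (hkl : k ≠ l) :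
    ∃ g σ, hAut m q g σ ∈ X ∧ ((σ i = k ∧ σ j = l) ∨ (σ i = l ∧ σ j = k)) := by
  choose f hf using fun n => exists_ne_symbol hq (α n)
  obtain ⟨g, σ, hX, hfix, hmap⟩ := hNT.exists_fixing (r := 2) (by norm_num) le_rfl (by omega) hα
    (hammingDist_update_update hij (hf i) (hf j)) (hammingDist_update_update hkl (hf k) (hf l))
  have hσ (n : Fin m) (hn : n = i ∨ n = j) : σ n = k ∨ σ n = l := by
    by_contra! h
    refine (apply_ne_iff_of_fixes hfix hmap n).2 ?_ ?_
    · rcases hn with rfl | rfl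
      · simpa [hij] using hf n
      · simpa using hf n
    · simp [h.1, h.2]
  have hne : σ i ≠ σ j := σ.injective.ne hij
  refine ⟨g, σ, hX, ?_⟩
  rcases hσ i (.inl rfl) with h | h <;> rcases hσ j (.inr rfl) with h' | h'
  · exact absurd (h.trans h'.symm) hne
  · exact .inl ⟨h, h'⟩
  · exact .inr ⟨h, h'⟩
  · exact absurd (h.trans h'.symm) hne

/-- An entry-faithful group of even order contains an element interchanging two entries. -/
theorem EntryFaithful.exists_swap (hEF : EntryFaithful m q X) (hX : X ≤ HammingAut m q)
    (hq : 2 ≤ q) (heven : 2 ∣ Nat.card X) :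
    ∃ g σ, hAut m q g σ ∈ X ∧ ∃ i j, i ≠ j ∧ σ i = j ∧ σ j = i := by
  have : Fact (Nat.Prime 2) := ⟨Nat.prime_two⟩
  obtain ⟨⟨x, hx⟩, hord⟩ := exists_prime_orderOf_dvd_card' (G := X) 2 heven
  rw [Subgroup.orderOf_mk] at hord
  obtain ⟨g, σ, rfl⟩ := hX hx
  have hsq := pow_orderOf_eq_one (hAut m q g σ)
  rw [hord, pow_two, hAut_mul] at hsq
  have hσσ := eq_one_of_hAut_eq_one hq hsq
  have hσ : σ ≠ 1 := by
    rintro rfl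
    have := hEF _ hx ⟨g, rfl⟩
    rw [this, orderOf_one] at hord
    omega
  obtain ⟨i, hi⟩ : ∃ i, σ i ≠ i := by
    by_contra! h
    exact hσ (Equiv.ext h)
  exact ⟨g, σ, hx, i, σ i, hi.symm, rfl, by simpa using congrArg (fun τ => τ i) hσσ⟩

/-- A permutation of the vertices of odd order cannot interchange two symbols in an entry. -/
theorem eq_of_swaps_symbols {x : Perm (V m q)} (hodd : Odd (orderOf x)) {i : Fin m} {a b : Fin q}
    (hab : ∀ v : V m q, v i = a → x v i = b) (hba : ∀ v : V m q, v i = b → x v i = a) :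
    a = b := by
  obtain ⟨k, hk⟩ := hodd
  have heven (n : ℕ) : ((x ^ (2 * n)) fun _ => a) i = a := by
    induction n with
    | zero => simp
    | succ n ih =>
      rw [show 2 * (n + 1) = 1 + (1 + 2 * n) by ring, pow_add, pow_add, pow_one]
      exact hba _ (hab _ ih)
  have h := hab _ (heven k)
  rw [← Perm.mul_apply, ← pow_succ', ← hk, pow_orderOf_eq_one] at h
  exact h

/-- If `X` has odd order, every element of `X` fixing an entry preserves the symbol of
each codeword in that entry. -/
theorem IsNT.apply_eq_of_odd (hNT : IsNT m q X C 2) (hδ : 5 ≤ minDist m q C)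
    (hodd : Odd (Nat.card X)) {α : V m q} (hα : α ∈ C) {g : Fin m → Perm (Fin q)}
    {σ : Perm (Fin m)} (hX : hAut m q g σ ∈ X) {i : Fin m} (hi : σ i = i) :
    g i (α i) = α i := by
  by_contra hne
  have hd : (g i).symm (α i) ≠ α i := fun h => hne ((Equiv.symm_apply_eq _).1 h).symm
  obtain ⟨h, τ, hY, hfix, hτ, hh⟩ := hNT.exists_fixing_symbol hδ hα hne hd
  have hhα : h i (α i) = α i := by
    have := hAut_apply_apply h τ α i
    rwa [hfix, hτ, eq_comm] at this
  have hval (v : V m q) : (hAut m q g σ * hAut m q h τ) v i = g i (h i (v i)) := by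
    have h1 := hAut_apply_apply g σ (hAut m q h τ v) i
    have h2 := hAut_apply_apply h τ v i
    rw [hi] at h1
    rw [hτ] at h2
    rw [Perm.mul_apply, h1, h2]
  have hord : Odd (orderOf (hAut m q g σ * hAut m q h τ)) := by
    have := orderOf_dvd_natCard (⟨_, X.mul_mem hX hY⟩ : X)
    rw [Subgroup.orderOf_mk] at this
    exact hodd.of_dvd_nat this
  refine hne (eq_of_swaps_symbols (i := i) hord (fun v hv => ?_) (fun v hv => ?_)).symm
  · rw [hval, hv, hhα]
  · rw [hval, hv, hh, Equiv.apply_symm_apply]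

/-- If `X` has odd order, then `X` fixes every codeword. -/
theorem IsNT.fixes_of_odd (hNT : IsNT m q X C 2) (hq : 2 ≤ q) (hδ : 5 ≤ minDist m q C)
    (hodd : Odd (Nat.card X)) {α : V m q} (hα : α ∈ C) {x : Perm (V m q)} (hx : x ∈ X) :
    x α = α := by
  obtain ⟨g, σ, rfl⟩ := hNT.1 hx
  funext k
  obtain ⟨i, rfl⟩ := σ.surjective k
  obtain ⟨a, ha⟩ := exists_ne_symbol hq (α (σ i))
  obtain ⟨b, hb⟩ := exists_ne_symbol hq (α i)
  obtain ⟨h, τ, hY, hfix, hτ, -⟩ := hNT.exists_fixing_symbol hδ hα ha hb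
  have hYX := X.mul_mem hY hx
  rw [hAut_mul] at hYX
  have h1 := hNT.apply_eq_of_odd hδ hodd hα hYX (i := i) hτ
  have h2 : τ⁻¹ i = σ i := Perm.inv_eq_iff_eq.2 hτ.symm
  have h3 := hAut_apply_apply h τ α (σ i)
  rw [hfix, hτ] at h3
  rw [Perm.mul_apply, h2] at h1
  rw [hAut_apply_apply]
  exact (h i).injective (h1.trans h3)

end NT

open NT Equiv in
/-- Corollary 2.9: an entry-faithful `(X,2)`-neighbour transitive code
with `|C| ≥ 2` and `δ ≥ 5` has `X` acting 2-transitively on the set of entries. -/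
theorem stmt_7 (m q : ℕ) (hm : 2 ≤ m) (hq : 2 ≤ q)
    (X : Subgroup (Perm (V m q))) (C : Set (V m q))
    (hC : 2 ≤ C.ncard) (hδ : 5 ≤ minDist m q C)
    (hNT : IsNT m q X C 2) (hEF : EntryFaithful m q X) :
    ∀ i j k l : Fin m, i ≠ j → k ≠ l →
      ∃ x ∈ X, ∃ g σ, x = hAut m q g σ ∧ σ i = k ∧ σ j = l := by
  obtain ⟨α, hα, β, hβ, hαβ⟩ := (Set.one_lt_ncard (Set.toFinite C)).1 hC
  have heven : 2 ∣ Nat.card X := by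
    by_contra h
    have hodd : Odd (Nat.card X) := by rwa [← Nat.not_even_iff_odd, even_iff_two_dvd]
    obtain ⟨x, hx, hxα⟩ := hNT.2.1.2.2 α hα β hβ
    exact hαβ ((hNT.fixes_of_odd hq hδ hodd hα hx).symm.trans hxα)
  obtain ⟨s, ρ, hs, a, b, hab, ha, hb⟩ := hEF.exists_swap hNT.1 hq heven
  intro i j k l hij hkl
  obtain ⟨g, σ, hg, hσ⟩ := hNT.exists_entry_pair hq hδ hα hij hab
  obtain ⟨h, τ, hh, hτ⟩ := hNT.exists_entry_pair hq hδ hα hab hkl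
  by_cases hc : τ (σ i) = k
  · refine ⟨_, X.mul_mem hh hg, _, _, hAut_mul h g τ σ, hc, ?_⟩
    rw [Perm.mul_apply]
    grind
  · have hmul := hAut_mul h s τ ρ
    refine ⟨_, X.mul_mem (X.mul_mem hh hs) hg, _, _, by rw [hmul, hAut_mul], ?_, ?_⟩ <;>
    · simp only [Perm.mul_apply]
      grind
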